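/- arXiv:2303.10660 — 3 statements merged into one kernel-verified Lean document; each statement's English description precedes it below -/
import Mathlib

section
/- For any 0 ≤ p' ≤ p, the maximal controlled invariant sets of the delayed disturbance-collaborative systems are nested: C_{max,p,co} ⊆ C_{max,p',co} × D^{p−p'} ⊆ C_{max,co} × D^{p}, where C_{max,k,co} denotes the maximal CIS of 𝒟(Σ_k) in S_{xu,k} × D and C_{max,co} = C_{max,0,co} is the maximal CIS of 𝒟(Σ) in S_{xu} × D. -/
open Set Pointwise

section Defs

variable {X U W : Type*}

/-- Robust controlled invariant set of `x⁺ = f x u d` (disturbance `d ∈ D`) in safe set `S`. -/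
def IsRCIS (f : X → U → W → X) (D : Set W) (S : Set (X × U)) (C : Set X) : Prop :=
  ∀ x ∈ C, ∃ u, (x, u) ∈ S ∧ ∀ d ∈ D, f x u d ∈ C

/-- Maximal RCIS: an RCIS containing every RCIS. -/
def IsMaxRCIS (f : X → U → W → X) (D : Set W) (S : Set (X × U)) (C : Set X) : Prop :=
  IsRCIS f D S C ∧ ∀ C', IsRCIS f D S C' → C' ⊆ C

/-- Controlled invariant set of the disturbance-free system `x⁺ = g x u` in safe set `S`. -/
def IsCIS (g : X → U → X) (S : Set (X × U)) (C : Set X) : Prop :=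
  ∀ x ∈ C, ∃ u, (x, u) ∈ S ∧ g x u ∈ C

/-- Maximal CIS. -/
def IsMaxCIS (g : X → U → X) (S : Set (X × U)) (C : Set X) : Prop :=
  IsCIS g S C ∧ ∀ C', IsCIS g S C' → C' ⊆ C

/-- One-step backward reachable set for a disturbance-free system. -/
def pre (g : X → U → X) (S : Set (X × U)) (T : Set X) : Set X :=
  {x | ∃ u, (x, u) ∈ S ∧ g x u ∈ T}

/-- `k`-step backward reachable set for a disturbance-free system. -/
def preN (g : X → U → X) (S : Set (X × U)) : ℕ → Set X → Set X
  | 0, T => T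
  | k + 1, T => pre g S (preN g S k T)

/-- One-step robust backward reachable set for a system with disturbance `d ∈ D`. -/
def preR (f : X → U → W → X) (D : Set W) (S : Set (X × U)) (T : Set X) : Set X :=
  {x | ∃ u, (x, u) ∈ S ∧ ∀ d ∈ D, f x u d ∈ T}

/-- `k`-step robust backward reachable set. -/
def preRN (f : X → U → W → X) (D : Set W) (S : Set (X × U)) : ℕ → Set X → Set X
  | 0, T => T
  | k + 1, T => preR f D S (preRN f D S k T)

/-- Dynamics of the `p`-augmented system `Σ_p`: state `(x, d_{1:p})`,
`x⁺ = f x u d₁`, `dᵢ⁺ = d_{i+1}`, `d_p⁺ = d` (new disturbance). -/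
def augDyn (f : X → U → W → X) (p : ℕ) :
    X × (Fin p → W) → U → W → X × (Fin p → W) :=
  fun s u dnew =>
    (f s.1 u (if h : 0 < p then s.2 ⟨0, h⟩ else dnew),
     fun i => if h : (i : ℕ) + 1 < p then s.2 ⟨(i : ℕ) + 1, h⟩ else dnew)

/-- Safe set `S_{xu,p}` of the `p`-augmented system. -/
def augSafe (S : Set (X × U)) (D : Set W) (p : ℕ) :
    Set ((X × (Fin p → W)) × U) :=
  {s | (s.1.1, s.2) ∈ S ∧ ∀ i, s.1.2 i ∈ D}

/-- Dynamics of the disturbance collaborative system `𝒟(Σ)`: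
the disturbance becomes a second control input. -/
def dcDyn (f : X → U → W → X) : X → U × W → X := fun x v => f x v.1 v.2

/-- Safe set `S_xu × D` of the disturbance collaborative system. -/
def dcSafe (S : Set (X × U)) (D : Set W) : Set (X × (U × W)) :=
  {s | (s.1, s.2.1) ∈ S ∧ s.2.2 ∈ D}

/-- The set `C × D^{p-p'}` viewed inside the state space of `Σ_p`, for `p' ≤ p`. -/
def liftSet {p' p : ℕ} (h : p' ≤ p) (C : Set (X × (Fin p' → W))) (D : Set W) :
    Set (X × (Fin p → W)) :=
  {s | (s.1, fun i : Fin p' => s.2 (Fin.castLE h i)) ∈ C ∧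
    ∀ i : Fin p, p' ≤ (i : ℕ) → s.2 i ∈ D}

/-- The set `C × D^p` viewed inside the state space of `Σ_p`, for `C ⊆ X`. -/
def prodD (C : Set X) (D : Set W) (p : ℕ) : Set (X × (Fin p → W)) :=
  {s | s.1 ∈ C ∧ ∀ i : Fin p, s.2 i ∈ D}

/-- The feasible domain `ℱ_p(C)` of the preview MPC with prediction horizon `p`
and terminal constraint set `C`. -/
def feasDom (f : X → U → W → X) (D : Set W) (S : Set (X × U)) (C : Set X) (p : ℕ) :
    Set (X × (Fin p → W)) :=
  {s | (∀ i, s.2 i ∈ D) ∧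
    ∃ xs : Fin (p + 1) → X, ∃ us : Fin p → U,
      xs 0 = s.1 ∧
      (∀ t : Fin p, xs t.succ = f (xs t.castSucc) (us t) (s.2 t) ∧
        (xs t.castSucc, us t) ∈ S) ∧
      xs (Fin.last p) ∈ C}

end Defs

/-- Linear dynamics `x⁺ = A x + B u + E d` on plain vector spaces `Fin n → ℝ`. -/
def linDyn {n m l : ℕ} (A : Matrix (Fin n) (Fin n) ℝ) (B : Matrix (Fin n) (Fin m) ℝ)
    (E : Matrix (Fin n) (Fin l) ℝ) :
    (Fin n → ℝ) → (Fin m → ℝ) → (Fin l → ℝ) → (Fin n → ℝ) :=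
  fun x u d => A.mulVec x + B.mulVec u + E.mulVec d

/-- Linear dynamics `x⁺ = A x + B u + E d` on Euclidean spaces. -/
noncomputable def linDynE {n m l : ℕ} (A : Matrix (Fin n) (Fin n) ℝ)
    (B : Matrix (Fin n) (Fin m) ℝ) (E : Matrix (Fin n) (Fin l) ℝ) :
    EuclideanSpace ℝ (Fin n) → EuclideanSpace ℝ (Fin m) → EuclideanSpace ℝ (Fin l) →
      EuclideanSpace ℝ (Fin n) :=
  fun x u d => (EuclideanSpace.equiv (Fin n) ℝ).symm
    (A.mulVec (EuclideanSpace.equiv (Fin n) ℝ x) + B.mulVec (EuclideanSpace.equiv (Fin m) ℝ u)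
      + E.mulVec (EuclideanSpace.equiv (Fin l) ℝ d))

/-- Truncating the disturbance preview maps a CIS of `𝒟(Σ_p)` to a CIS of `𝒟(Σ_q)`, `q ≤ p`. -/
theorem IsCIS.image_truncate {X U W : Type*} {f : X → U → W → X} {D : Set W} {S : Set (X × U)}
    {q p : ℕ} (h : q ≤ p) {C : Set (X × (Fin p → W))}
    (hC : IsCIS (dcDyn (augDyn f p)) (dcSafe (augSafe S D p) D) C) :
    IsCIS (dcDyn (augDyn f q)) (dcSafe (augSafe S D q) D)
      ((fun s : X × (Fin p → W) => (s.1, fun i : Fin q => s.2 (Fin.castLE h i))) '' C) := by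
  rintro _ ⟨s, hs, rfl⟩
  obtain ⟨⟨u, v⟩, ⟨⟨hxu, hD⟩, hv⟩, hnext⟩ := hC s hs
  refine ⟨(u, if hlt : q < p then s.2 ⟨q, hlt⟩ else v), ⟨⟨hxu, fun i => hD _⟩, ?_⟩,
    _, hnext, ?_⟩
  · dsimp only
    split_ifs with hlt
    · exact hD _
    · exact hv
  · have key : ∀ k ≤ q, (if hk : k < p then s.2 ⟨k, hk⟩ else v) =
        if hk : k < q then s.2 ⟨k, hk.trans_le h⟩
          else if hlt : q < p then s.2 ⟨q, hlt⟩ else v := by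
      intro k hk
      rcases hk.lt_or_eq with hlt | rfl
      · rw [dif_pos (hlt.trans_le h), dif_pos hlt]
      · rw [dif_neg (lt_irrefl k)]
    refine Prod.ext ?_ (funext fun i => ?_)
    · exact congrArg (f s.1 u) (key 0 q.zero_le)
    · exact key (i + 1) i.isLt

/-- Forgetting the disturbance preview maps a CIS of `𝒟(Σ_p)` to a CIS of `𝒟(Σ)`. -/
theorem IsCIS.image_fst {X U W : Type*} {f : X → U → W → X} {D : Set W} {S : Set (X × U)}
    {p : ℕ} {C : Set (X × (Fin p → W))}
    (hC : IsCIS (dcDyn (augDyn f p)) (dcSafe (augSafe S D p) D) C) :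
    IsCIS (dcDyn f) (dcSafe S D) (Prod.fst '' C) := by
  rintro _ ⟨s, hs, rfl⟩
  obtain ⟨⟨u, v⟩, ⟨⟨hxu, hD⟩, hv⟩, hnext⟩ := hC s hs
  refine ⟨(u, if hlt : 0 < p then s.2 ⟨0, hlt⟩ else v), ⟨hxu, ?_⟩, _, hnext, rfl⟩
  dsimp only
  split_ifs with hlt
  · exact hD _
  · exact hv

/-- The previewed disturbances of a state in a CIS of `𝒟(Σ_p)` lie in `D`. -/
theorem IsCIS.preview_mem {X U W : Type*} {f : X → U → W → X} {D : Set W} {S : Set (X × U)}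
    {p : ℕ} {C : Set (X × (Fin p → W))}
    (hC : IsCIS (dcDyn (augDyn f p)) (dcSafe (augSafe S D p) D) C)
    {s : X × (Fin p → W)} (hs : s ∈ C) (i : Fin p) : s.2 i ∈ D := by
  obtain ⟨_, ⟨⟨_, hD⟩, _⟩, _⟩ := hC s hs
  exact hD i

/-- **Nestedness of the maximal CISs of the delayed disturbance-collaborative systems.**
For `0 ≤ p' ≤ p`, `C_{max,p,co} ⊆ C_{max,p',co} × D^{p-p'} ⊆ C_{max,co} × D^p`. -/
theorem maxCIS_delayed_nested {n m l : ℕ}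
    (f : (Fin n → ℝ) → (Fin m → ℝ) → (Fin l → ℝ) → (Fin n → ℝ))
    (D : Set (Fin l → ℝ)) (hDcpt : IsCompact D)
    (S : Set ((Fin n → ℝ) × (Fin m → ℝ)))
    (p p' : ℕ) (hpp' : p' ≤ p)
    (Cpco : Set ((Fin n → ℝ) × (Fin p → (Fin l → ℝ))))
    (Cp'co : Set ((Fin n → ℝ) × (Fin p' → (Fin l → ℝ))))
    (Cco : Set (Fin n → ℝ))
    (hCpco : IsMaxCIS (dcDyn (augDyn f p)) (dcSafe (augSafe S D p) D) Cpco)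
    (hCp'co : IsMaxCIS (dcDyn (augDyn f p')) (dcSafe (augSafe S D p') D) Cp'co)
    (hCco : IsMaxCIS (dcDyn f) (dcSafe S D) Cco) :
    Cpco ⊆ liftSet hpp' Cp'co D ∧ liftSet hpp' Cp'co D ⊆ prodD Cco D p := by
  refine ⟨fun s hs => ⟨hCp'co.2 _ (hCpco.1.image_truncate hpp') ⟨s, hs, rfl⟩,
    fun i _ => hCpco.1.preview_mem hs i⟩, ?_⟩
  rintro s ⟨hs, hD⟩
  refine ⟨hCco.2 _ hCp'co.1.image_fst ⟨_, hs, rfl⟩, fun i => ?_⟩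
  rcases lt_or_ge (i : ℕ) p' with hi | hi
  · exact hCp'co.1.preview_mem hs ⟨i, hi⟩
  · exact hD i hi
end

section
/- For any system Σ with safe set S_xu, preview horizon p, and any k > 0, the k-step backward reachable set of the projection π_n(C_{max,p}) with respect to the disturbance collaborative system 𝒟(Σ) satisfies Pre^k_{𝒟(Σ)}(π_n(C_{max,p}), S_xu × D) ⊆ π_n(C_{max,p+k}) ⊆ C_{max,co}, where C_{max,p} and C_{max,p+k} are the maximal RCISs of the p- and (p+k)-augmented systems in their respective safe sets, and C_{max,co} is the maximal CIS of 𝒟(Σ) in S_xu × D. -/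
open Set Pointwise

section Helpers

variable {X U W : Type*}

/-- The states of the `(p+1)`-augmented system, with previewed disturbances in `D`, from which some
safe input steers the `p`-augmented system into `C`. -/
def augPre (f : X → U → W → X) (D : Set W) (S : Set (X × U)) (p : ℕ)
    (C : Set (X × (Fin p → W))) : Set (X × (Fin (p + 1) → W)) :=
  {s | (∀ i, s.2 i ∈ D) ∧ ∃ u, (s.1, u) ∈ S ∧ (f s.1 u (s.2 0), fun i : Fin p => s.2 i.succ) ∈ C}

lemma isRCIS_augPre {f : X → U → W → X} {D : Set W} {S : Set (X × U)} {p : ℕ}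
    {C : Set (X × (Fin p → W))} (hC : IsRCIS (augDyn f p) D (augSafe S D p) C) :
    IsRCIS (augDyn f (p + 1)) D (augSafe S D (p + 1)) (augPre f D S p C) := by
  rintro ⟨x, d⟩ ⟨hd, u, hxu, hy⟩
  refine ⟨u, ⟨hxu, hd⟩, fun e he => ?_⟩
  obtain ⟨v, ⟨hyv, -⟩, hnext⟩ := hC _ hy
  refine ⟨fun i => ?_, v, ?_, ?_⟩
  · dsimp only [augDyn]
    split_ifs
    exacts [hd _, he]
  · simpa [augDyn] using hyv
  · convert hnext e he using 1
    simp [augDyn]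

lemma pre_proj_subset_proj_augPre {f : X → U → W → X} {D : Set W} {S : Set (X × U)} {p : ℕ}
    {C : Set (X × (Fin p → W))} (hC : IsRCIS (augDyn f p) D (augSafe S D p) C) :
    pre (dcDyn f) (dcSafe S D) (Prod.fst '' C) ⊆ Prod.fst '' augPre f D S p C := by
  rintro x ⟨⟨u, e⟩, ⟨hxu, he⟩, ⟨y, d⟩, hy, hyx⟩
  obtain ⟨_, ⟨_, hd⟩, _⟩ := hC _ hy
  refine ⟨(x, Fin.cons e d), ⟨Fin.cases he hd, u, hxu, ?_⟩, rfl⟩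
  have hyx' : y = f x u e := hyx
  simpa [← hyx'] using hy

lemma pre_mono (g : X → U → X) (S : Set (X × U)) {T T' : Set X} (h : T ⊆ T') :
    pre g S T ⊆ pre g S T' :=
  fun _ ⟨u, hu, hT⟩ => ⟨u, hu, h hT⟩

lemma exists_isRCIS_preN_proj_subset {f : X → U → W → X} {D : Set W} {S : Set (X × U)} {p : ℕ}
    {C : Set (X × (Fin p → W))} (hC : IsRCIS (augDyn f p) D (augSafe S D p) C) (k : ℕ) :
    ∃ C' : Set (X × (Fin (p + k) → W)),
      IsRCIS (augDyn f (p + k)) D (augSafe S D (p + k)) C' ∧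
        preN (dcDyn f) (dcSafe S D) k (Prod.fst '' C) ⊆ Prod.fst '' C' := by
  induction k with
  | zero => exact ⟨C, hC, subset_rfl⟩
  | succ k ih =>
    obtain ⟨C', hC', hsub⟩ := ih
    exact ⟨augPre f D S (p + k) C', isRCIS_augPre hC',
      (pre_mono _ _ hsub).trans (pre_proj_subset_proj_augPre hC')⟩

lemma isCIS_proj {f : X → U → W → X} {D : Set W} {S : Set (X × U)} {p : ℕ} (hp : 0 < p)
    {C : Set (X × (Fin p → W))} (hC : IsRCIS (augDyn f p) D (augSafe S D p) C) :
    IsCIS (dcDyn f) (dcSafe S D) (Prod.fst '' C) := by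
  rintro _ ⟨⟨x, d⟩, hx, rfl⟩
  obtain ⟨u, ⟨hxu, hd⟩, hnext⟩ := hC _ hx
  refine ⟨(u, d ⟨0, hp⟩), ⟨hxu, hd _⟩, _, hnext _ (hd ⟨0, hp⟩), ?_⟩
  simp [augDyn, dcDyn, hp]

end Helpers

/-- **Lemma (backward reachable sets of the projections expand into the projections).**
For any `k > 0`, `Pre^k_{𝒟(Σ)}(π_n(C_{max,p}), S_xu × D) ⊆ π_n(C_{max,p+k}) ⊆ C_{max,co}`. -/
theorem preN_proj_maxRCIS_subset {n m l : ℕ}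
    (f : (Fin n → ℝ) → (Fin m → ℝ) → (Fin l → ℝ) → (Fin n → ℝ))
    (D : Set (Fin l → ℝ)) (hDcpt : IsCompact D)
    (S : Set ((Fin n → ℝ) × (Fin m → ℝ)))
    (p k : ℕ) (hk : 0 < k)
    (Cp : Set ((Fin n → ℝ) × (Fin p → (Fin l → ℝ))))
    (Cpk : Set ((Fin n → ℝ) × (Fin (p + k) → (Fin l → ℝ))))
    (Cco : Set (Fin n → ℝ))
    (hCp : IsMaxRCIS (augDyn f p) D (augSafe S D p) Cp)
    (hCpk : IsMaxRCIS (augDyn f (p + k)) D (augSafe S D (p + k)) Cpk)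
    (hCco : IsMaxCIS (dcDyn f) (dcSafe S D) Cco) :
    preN (dcDyn f) (dcSafe S D) k (Prod.fst '' Cp) ⊆ Prod.fst '' Cpk ∧
      Prod.fst '' Cpk ⊆ Cco := by
  obtain ⟨C', hC', hsub⟩ := exists_isRCIS_preN_proj_subset hCp.1 k
  exact ⟨hsub.trans (image_mono (hCpk.2 C' hC')),
    hCco.2 _ (isCIS_proj (Nat.add_pos_right p hk) hCpk.1)⟩
end

section
/- Let Σ be linear with convex compact S_xu and D containing the origin (a forced equilibrium) in their product's interior, and suppose γ C_{max,co} is an N-step λ-contractive CIS of 𝒟(Σ) in S_xu × D for some γ ∈ (0,1], N ≥ 1, λ ∈ [0,1]. Then for any ξ ∈ (0,1]: if ξ ≤ λγ, then (ξ/λ) C_{max,co} ⊆ Pre^N_{𝒟(Σ)}(ξ C_{max,co}, S_xu × D); and if ξ > λγ, then g(ξ) C_{max,co} ⊆ Pre^N_{𝒟(Σ)}(ξ C_{max,co}, S_xu × D), where g(ξ) = ξ(1−γ)/(1−γλ) + γ(1−λ)/(1−γλ). -/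
open Set Pointwise

lemma convex_dcSafe {X U W : Type*} [AddCommGroup X] [Module ℝ X] [AddCommGroup U] [Module ℝ U]
    [AddCommGroup W] [Module ℝ W] {S : Set (X × U)} {D : Set W}
    (hS : Convex ℝ S) (hD : Convex ℝ D) : Convex ℝ (dcSafe S D) :=
  fun _ hx _ hy _ _ ha hb hab => ⟨hS hx.1 hy.1 ha hb hab, hD hx.2 hy.2 ha hb hab⟩

lemma dcDyn_linDyn_combo {n m l : ℕ} (A : Matrix (Fin n) (Fin n) ℝ)
    (B : Matrix (Fin n) (Fin m) ℝ) (E : Matrix (Fin n) (Fin l) ℝ) (a b : ℝ)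
    (x y : Fin n → ℝ) (u v : (Fin m → ℝ) × (Fin l → ℝ)) :
    dcDyn (linDyn A B E) (a • x + b • y) (a • u + b • v) =
      a • dcDyn (linDyn A B E) x u + b • dcDyn (linDyn A B E) y v := by
  simp only [dcDyn, linDyn, Prod.fst_add, Prod.snd_add, Prod.smul_fst, Prod.smul_snd,
    Matrix.mulVec_add, Matrix.mulVec_smul, smul_add]
  abel

section Combo

variable {X V : Type*} {g : X → V → X} {S : Set (X × V)}

lemma IsCIS.subset_preN {C : Set X} (hC : IsCIS g S C) (N : ℕ) : C ⊆ preN g S N C := by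
  induction N with
  | zero => exact subset_rfl
  | succ k ih =>
    intro x hx
    obtain ⟨u, hu, hgu⟩ := hC x hx
    exact ⟨u, hu, ih hgu⟩

variable [AddCommGroup X] [Module ℝ X] [AddCommGroup V] [Module ℝ V]

lemma preN_combo {a b : ℝ} (hS : Convex ℝ S)
    (hg : ∀ x y u v, g (a • x + b • y) (a • u + b • v) = a • g x u + b • g y v)
    (ha : 0 ≤ a) (hb : 0 ≤ b) (hab : a + b = 1) {T₁ T₂ T : Set X}
    (hT : ∀ p ∈ T₁, ∀ q ∈ T₂, a • p + b • q ∈ T) (N : ℕ) :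
    ∀ x ∈ preN g S N T₁, ∀ y ∈ preN g S N T₂, a • x + b • y ∈ preN g S N T := by
  induction N with
  | zero => exact hT
  | succ k ih =>
    rintro x ⟨u, hu, hgu⟩ y ⟨v, hv, hgv⟩
    refine ⟨a • u + b • v, hS hu hv ha hb hab, ?_⟩
    rw [hg]
    exact ih _ hgu _ hgv

lemma IsMaxCIS.convex {C : Set X} (hS : Convex ℝ S)
    (hg : ∀ (a b : ℝ) x y u v, g (a • x + b • y) (a • u + b • v) = a • g x u + b • g y v)
    (hC : IsMaxCIS g S C) : Convex ℝ C := by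
  intro x hx y hy a b ha hb hab
  refine hC.2 {z | ∃ p ∈ C, ∃ q ∈ C, a • p + b • q = z} ?_ ⟨x, hx, y, hy, rfl⟩
  rintro _ ⟨p, hp, q, hq, rfl⟩
  obtain ⟨u, hu, hgu⟩ := hC.1 p hp
  obtain ⟨v, hv, hgv⟩ := hC.1 q hq
  exact ⟨a • u + b • v, hS hu hv ha hb hab, _, hgu, _, hgv, (hg ..).symm⟩

end Combo

/-- **Lemma (one-step convergence estimate for scaled maximal CISs).**
If `γ C_{max,co}` is an `N`-step `λ`-contractive CIS of `𝒟(Σ)` in `S_xu × D`, then for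
any `ξ ∈ (0,1]`: if `ξ ≤ λγ` then `(ξ/λ) C_{max,co} ⊆ Pre^N(ξ C_{max,co})`, and if
`ξ > λγ` then `g(ξ) C_{max,co} ⊆ Pre^N(ξ C_{max,co})` where
`g(ξ) = ξ(1-γ)/(1-γλ) + γ(1-λ)/(1-γλ)`. -/
theorem one_step_convergence_scaled_maxCIS {n m l : ℕ}
    (A : Matrix (Fin n) (Fin n) ℝ) (B : Matrix (Fin n) (Fin m) ℝ)
    (E : Matrix (Fin n) (Fin l) ℝ)
    (D : Set (Fin l → ℝ)) (S : Set ((Fin n → ℝ) × (Fin m → ℝ)))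
    (hDconv : Convex ℝ D) (hDcpt : IsCompact D)
    (hSconv : Convex ℝ S) (hScpt : IsCompact S)
    (h0int : ((0 : Fin n → ℝ), ((0 : Fin m → ℝ), (0 : Fin l → ℝ))) ∈
      interior (dcSafe S D))
    (Cco : Set (Fin n → ℝ))
    (hCco : IsMaxCIS (dcDyn (linDyn A B E)) (dcSafe S D) Cco)
    (γ : ℝ) (hγ0 : 0 < γ) (hγ1 : γ ≤ 1)
    (N : ℕ) (hN : 0 < N)
    (lam : ℝ) (hlam0 : 0 ≤ lam) (hlam1 : lam ≤ 1)
    (hcontr : γ • Cco ⊆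
      preN (dcDyn (linDyn A B E)) (dcSafe S D) N ((lam * γ) • Cco)) :
    ∀ ξ : ℝ, 0 < ξ → ξ ≤ 1 →
      (ξ ≤ lam * γ →
        (ξ / lam) • Cco ⊆ preN (dcDyn (linDyn A B E)) (dcSafe S D) N (ξ • Cco)) ∧
      (lam * γ < ξ →
        (ξ * (1 - γ) / (1 - γ * lam) + γ * (1 - lam) / (1 - γ * lam)) • Cco ⊆
          preN (dcDyn (linDyn A B E)) (dcSafe S D) N (ξ • Cco)) := by
  have hS := convex_dcSafe hSconv hDconv
  have hg := dcDyn_linDyn_combo A B E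
  have hconv := hCco.convex hS hg
  have h0 : IsCIS (dcDyn (linDyn A B E)) (dcSafe S D) {0} := by
    rintro _ rfl
    exact ⟨0, interior_subset h0int, by simp [dcDyn, linDyn]⟩
  intro ξ hξ0 hξ1
  constructor
  · intro hξ
    have hlg : 0 < lam * γ := hξ0.trans_le hξ
    have hlam : 0 < lam := pos_of_mul_pos_left hlg hγ0.le
    rintro _ ⟨c, hc, rfl⟩
    have hs : ξ / (lam * γ) ≤ 1 := (div_le_one hlg).2 hξ
    have hx := preN_combo (a := ξ / (lam * γ)) (b := 1 - ξ / (lam * γ)) (T := ξ • Cco) hS (hg _ _)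
      (by positivity) (by linarith) (by ring) (T₁ := (lam * γ) • Cco) (T₂ := {0})
      (by
        rintro _ ⟨p, hp, rfl⟩ _ rfl
        refine ⟨p, hp, ?_⟩
        simp only [smul_zero, add_zero, smul_smul]
        rw [div_mul_cancel₀ _ hlg.ne'])
      N _ (hcontr (smul_mem_smul_set hc)) 0 (h0.subset_preN N rfl)
    convert hx using 1
    simp only [smul_zero, add_zero, smul_smul]
    congr 1
    field_simp
  · intro hξ
    have hd : 0 < 1 - γ * lam := by linarith [mul_comm γ lam]
    rintro _ ⟨c, hc, rfl⟩
    set t := (ξ - lam * γ) / (1 - γ * lam) with ht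
    have ht0 : 0 ≤ t := div_nonneg (by linarith) hd.le
    have ht1 : 0 ≤ 1 - t := by
      rw [sub_nonneg, div_le_one hd]
      linarith [mul_comm γ lam]
    have hξt : (1 - t) * (lam * γ) + t = ξ := by
      have h : t * (1 - γ * lam) = ξ - lam * γ := div_mul_cancel₀ _ hd.ne'
      linear_combination h
    have hx := preN_combo (a := 1 - t) (b := t) (T := ξ • Cco) hS (hg _ _)
      ht1 ht0 (by ring) (T₁ := (lam * γ) • Cco) (T₂ := Cco)
      (by
        rintro _ ⟨p, hp, rfl⟩ q hq
        have h := hconv.add_smul (p := (1 - t) * (lam * γ)) (q := t) (by positivity) ht0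
        rw [← hξt, h]
        refine add_mem_add ⟨p, hp, ?_⟩ (smul_mem_smul_set hq)
        simp only [smul_smul])
      N _ (hcontr (smul_mem_smul_set hc)) c (hCco.1.subset_preN N hc)
    convert hx using 1
    simp only [smul_smul, ← add_smul]
    congr 1
    rw [ht]
    field_simp
    ring
end
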